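/- Let P : C →_A C' be an execution step and let u be a node with u ∈ A_s and children'(u) ∩ A_b = ∅. Then u ∉ B'. -/

import Mathlib

open scoped Classical

/-- A pre-configuration: a finite node set `V` with a partial parent map
(`none` means the node has no parent) and an integer height assignment. -/
structure PreConfig (V : Type*) where
  parent : V → Option V
  height : V → ℤ

namespace PreConfig

variable {V : Type*} [Fintype V] [LinearOrder V]

/-- The children of `u` are the nodes whose parent is `u`. -/
noncomputable def children (C : PreConfig V) (u : V) : Finset V :=
  Finset.univ.filter (fun v => C.parent v = some u)

/-- A leaf is a node with no children. -/
def IsLeaf (C : PreConfig V) (u : V) : Prop := C.children u = ∅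

/-- Maximum height value among the children of `u` (junk value `0` for a leaf). -/
noncomputable def maxH (C : PreConfig V) (u : V) : ℤ :=
  if h : (C.children u).Nonempty then (C.children u).sup' h C.height else 0

/-- Minimum height value among the children of `u` (junk value `0` for a leaf). -/
noncomputable def minH (C : PreConfig V) (u : V) : ℤ :=
  if h : (C.children u).Nonempty then (C.children u).inf' h C.height else 0

/-- A child of `u` of maximum height value; ties broken by a fixed rule
(smallest ID). Junk value `u` for a leaf. -/
noncomputable def maxChild (C : PreConfig V) (u : V) : V :=
  if h : ((C.children u).filter fun v => C.height v = C.maxH u).Nonempty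
  then ((C.children u).filter fun v => C.height v = C.maxH u).min' h else u

/-- A child of `u` of minimum height value; ties broken by a fixed rule
(smallest ID). Junk value `u` for a leaf. -/
noncomputable def minChild (C : PreConfig V) (u : V) : V :=
  if h : ((C.children u).filter fun v => C.height v = C.minH u).Nonempty
  then ((C.children u).filter fun v => C.height v = C.minH u).min' h else u

/-- `stable(u)`: `h(u) = 0` if `u` is a leaf, and `h(u) = 1 + max_{w child of u} h(w)` otherwise. -/
def Stable (C : PreConfig V) (u : V) : Prop :=
  (C.IsLeaf u ∧ C.height u = 0) ∨ (¬ C.IsLeaf u ∧ C.height u = 1 + C.maxH u)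

/-- `balanced(u)`: `|h(z) − h(z')| ≤ α` for all children `z, z'` of `u`. -/
def Balanced (α : ℤ) (C : PreConfig V) (u : V) : Prop :=
  ∀ z ∈ C.children u, ∀ z' ∈ C.children u, |C.height z - C.height z'| ≤ α

/-- `u` is enabled for a height update iff `¬stable(u)`. -/
def UpdateEnabled (C : PreConfig V) (u : V) : Prop := ¬ C.Stable u

/-- `u` is enabled for a swap iff `stable(u) ∧ stable(max(u)) ∧ ¬balanced(u)`. -/
def SwapEnabled (α : ℤ) (C : PreConfig V) (u : V) : Prop :=
  C.Stable u ∧ C.Stable (C.maxChild u) ∧ ¬ Balanced α C u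

/-- `u` is enabled iff it is enabled for a height update or for a swap. -/
def Enabled (α : ℤ) (C : PreConfig V) (u : V) : Prop :=
  C.UpdateEnabled u ∨ SwapEnabled α C u

/-- The value written by a height update: `0` for a leaf, `1 + max_{w child of u} h(w)` otherwise. -/
noncomputable def newHeight (C : PreConfig V) (u : V) : ℤ :=
  if C.IsLeaf u then 0 else 1 + C.maxH u

/-- A bad node: an internal node `u` with `h(u) ≤ max_{v child of u} h(v)`,
or a leaf `u` with `h(u) < 0`. -/
def Bad (C : PreConfig V) (u : V) : Prop :=
  (¬ C.IsLeaf u ∧ C.height u ≤ C.maxH u) ∨ (C.IsLeaf u ∧ C.height u < 0)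

/-- `v` reaches `a` by iterating the parent map. -/
def Reaches (C : PreConfig V) (v a : V) : Prop :=
  Relation.ReflTransGen (fun x y => C.parent x = some y) v a

/-- The underlying graph is a rooted tree with root `r`: `r` has no parent,
every other node has a (unique) parent, and every node reaches `r` by
iterating the parent map. -/
def IsTree (C : PreConfig V) (r : V) : Prop :=
  C.parent r = none ∧ (∀ v, C.parent v = none → v = r) ∧ ∀ v, C.Reaches v r

/-- The subtree `S_u` of `u`: the set of descendants of `u` (including `u`). -/
def subtree (C : PreConfig V) (u : V) : Set V := {v | C.Reaches v u}

/-- The actual height `h*(u)` of `u`: the length of a longest directed path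
going downward from `u` (such a maximal path necessarily ends at a leaf of `S_u`). -/
noncomputable def hstar (C : PreConfig V) (u : V) : ℕ :=
  sSup {n : ℕ | ∃ f : ℕ → V, f 0 = u ∧ ∀ i < n, C.parent (f (i + 1)) = some (f i)}

/-- An execution step `C →_A C'`: a nonempty set `A` of nodes enabled in `C` is
activated simultaneously; each `u ∈ A` enabled for a height update sets its height
to `newHeight`; each `u ∈ A` enabled for a swap replaces the edges `(u, min(u))` and
`(max(u), max(max(u)))` by `(u, max(max(u)))` and `(max(u), min(u))` (all guards and
functions evaluated in `C`); everything else is unchanged. -/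
structure Step (α : ℤ) (C C' : PreConfig V) (A : Finset V) : Prop where
  nonempty : A.Nonempty
  all_enabled : ∀ u ∈ A, Enabled α C u
  height_update : ∀ u ∈ A, C.UpdateEnabled u → C'.height u = C.newHeight u
  height_keep : ∀ u, ¬ (u ∈ A ∧ C.UpdateEnabled u) → C'.height u = C.height u
  swap_out : ∀ u ∈ A, SwapEnabled α C u → C'.parent (C.minChild u) = some (C.maxChild u)
  swap_in : ∀ u ∈ A, SwapEnabled α C u → C'.parent (C.maxChild (C.maxChild u)) = some u
  parent_keep : ∀ v, (∀ u ∈ A, SwapEnabled α C u →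
      v ≠ C.minChild u ∧ v ≠ C.maxChild (C.maxChild u)) → C'.parent v = C.parent v

end PreConfig

namespace PreConfig

variable {V : Type*} [Fintype V] [LinearOrder V]

theorem height_le_maxH (C : PreConfig V) {u v : V} (hv : v ∈ C.children u) :
    C.height v ≤ C.maxH u := by
  rw [maxH, dif_pos ⟨v, hv⟩]
  exact Finset.le_sup' C.height hv

theorem minH_le_height (C : PreConfig V) {u v : V} (hv : v ∈ C.children u) :
    C.minH u ≤ C.height v := by
  rw [minH, dif_pos ⟨v, hv⟩]
  exact Finset.inf'_le C.height hv

theorem exists_height_eq_maxH (C : PreConfig V) {u : V} (hu : (C.children u).Nonempty) :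
    ∃ v ∈ C.children u, C.height v = C.maxH u := by
  obtain ⟨v, hv, h⟩ := Finset.exists_mem_eq_sup' hu C.height
  exact ⟨v, hv, by rw [maxH, dif_pos hu, h]⟩

theorem exists_height_eq_minH (C : PreConfig V) {u : V} (hu : (C.children u).Nonempty) :
    ∃ v ∈ C.children u, C.height v = C.minH u := by
  obtain ⟨v, hv, h⟩ := Finset.exists_mem_eq_inf' hu C.height
  exact ⟨v, hv, by rw [minH, dif_pos hu, h]⟩

theorem height_maxChild (C : PreConfig V) {u : V} (hu : (C.children u).Nonempty) :
    C.height (C.maxChild u) = C.maxH u := by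
  obtain ⟨v, hv, h⟩ := C.exists_height_eq_maxH hu
  have hne : ((C.children u).filter fun v => C.height v = C.maxH u).Nonempty :=
    ⟨v, Finset.mem_filter.2 ⟨hv, h⟩⟩
  rw [maxChild, dif_pos hne]
  exact (Finset.mem_filter.1 (Finset.min'_mem _ hne)).2

theorem height_minChild (C : PreConfig V) {u : V} (hu : (C.children u).Nonempty) :
    C.height (C.minChild u) = C.minH u := by
  obtain ⟨v, hv, h⟩ := C.exists_height_eq_minH hu
  have hne : ((C.children u).filter fun v => C.height v = C.minH u).Nonempty :=
    ⟨v, Finset.mem_filter.2 ⟨hv, h⟩⟩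
  rw [minChild, dif_pos hne]
  exact (Finset.mem_filter.1 (Finset.min'_mem _ hne)).2

theorem maxChild_of_not_nonempty (C : PreConfig V) {u : V} (hu : ¬ (C.children u).Nonempty) :
    C.maxChild u = u :=
  dif_neg fun ⟨v, hv⟩ => hu ⟨v, (Finset.mem_filter.1 hv).1⟩

/-- The child of maximum height of a stable node (or the node itself, for a leaf) is not higher
than the node. -/
theorem Stable.height_maxChild_le {C : PreConfig V} {u : V} (h : C.Stable u) :
    C.height (C.maxChild u) ≤ C.height u := by
  by_cases hu : (C.children u).Nonempty
  · rcases h with ⟨hl, -⟩ | ⟨-, h⟩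
    · exact absurd hl hu.ne_empty
    · rw [C.height_maxChild hu, h]
      omega
  · rw [C.maxChild_of_not_nonempty hu]

theorem Stable.height_eq {C : PreConfig V} {u : V} (h : C.Stable u)
    (hu : (C.children u).Nonempty) : C.height u = 1 + C.maxH u :=
  h.elim (fun h => absurd h.1 hu.ne_empty) (fun h => h.2)

theorem nonempty_children_of_not_balanced {α : ℤ} {C : PreConfig V} {u : V}
    (h : ¬ Balanced α C u) : (C.children u).Nonempty := by
  by_contra hu
  exact h fun z hz => absurd ⟨z, hz⟩ hu

theorem minH_add_lt_maxH {α : ℤ} {C : PreConfig V} {u : V} (h : ¬ Balanced α C u) :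
    C.minH u + α < C.maxH u := by
  by_contra hlt
  refine h fun z hz z' hz' => abs_le.2 ?_
  have := C.height_le_maxH hz
  have := C.height_le_maxH hz'
  have := C.minH_le_height hz
  have := C.minH_le_height hz'
  constructor <;> omega

theorem newHeight_le_height_of_not_bad {C : PreConfig V} {v : V} (h : ¬ C.Bad v) :
    C.newHeight v ≤ C.height v := by
  unfold Bad at h
  unfold newHeight
  split_ifs with hl
  · by_contra hlt
    exact h (Or.inr ⟨hl, by omega⟩)
  · by_contra hlt
    exact h (Or.inl ⟨hl, by omega⟩)

/-- Heights do not increase in a step, except by height updates of bad nodes. -/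
theorem Step.height_le {α : ℤ} {C C' : PreConfig V} {A : Finset V} (hstep : Step α C C' A) {v : V}
    (hv : ¬ (v ∈ A ∧ C.Bad v ∧ C.UpdateEnabled v)) : C'.height v ≤ C.height v := by
  by_cases h : v ∈ A ∧ C.UpdateEnabled v
  · rw [hstep.height_update v h.1 h.2]
    exact newHeight_le_height_of_not_bad fun hb => hv ⟨h.1, hb, h.2⟩
  · exact (hstep.height_keep v h).le

/-- Every child that a swap source has after a step was lower than the source before it. -/
theorem Step.height_lt_of_mem_children {α : ℤ} (hα : 0 ≤ α) {C C' : PreConfig V} {A : Finset V}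
    (hstep : Step α C C' A) {u v : V} (huS : SwapEnabled α C u) (hv : v ∈ C'.children u) :
    C.height v < C.height u := by
  have hpv : C'.parent v = some u := (Finset.mem_filter.1 hv).2
  have hne := nonempty_children_of_not_balanced huS.2.2
  have hu := huS.1.height_eq hne
  have hm := C.height_maxChild hne
  by_cases hk : ∀ w ∈ A, SwapEnabled α C w →
      v ≠ C.minChild w ∧ v ≠ C.maxChild (C.maxChild w)
  · rw [hstep.parent_keep v hk] at hpv
    have := C.height_le_maxH (Finset.mem_filter.2 ⟨Finset.mem_univ v, hpv⟩)
    omega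
  · push Not at hk
    obtain ⟨w, hwA, hw, hvw⟩ := hk
    by_cases hmin : v = C.minChild w
    · have hwu : C.maxChild w = u :=
        Option.some.inj ((hstep.swap_out w hwA hw).symm.trans (hmin ▸ hpv))
      have hwne := nonempty_children_of_not_balanced hw.2.2
      have := C.height_maxChild hwne
      have := minH_add_lt_maxH hw.2.2
      rw [hmin, C.height_minChild hwne, ← hwu]
      omega
    · have hmax := hvw hmin
      have hwu : w = u :=
        Option.some.inj ((hstep.swap_in w hwA hw).symm.trans (hmax ▸ hpv))
      have := hw.2.1.height_maxChild_le
      rw [hmax]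
      subst hwu
      omega

end PreConfig

/-- Let `C →_A C'` be an execution step and `u` a node with `u ∈ A_s`
(an activated node performing a swap) and `children'(u) ∩ A_b = ∅`. Then `u ∉ B'`. -/
theorem stmt13 {V : Type*} [Fintype V] [LinearOrder V] (α : ℤ) (hα : 1 ≤ α)
    (C C' : PreConfig V) (A : Finset V) (r : V)
    (hT : C.IsTree r) (hstep : PreConfig.Step α C C' A)
    (u : V) (huA : u ∈ A) (huS : PreConfig.SwapEnabled α C u)
    (hch : ∀ v ∈ C'.children u, ¬ (v ∈ A ∧ C.Bad v ∧ C.UpdateEnabled v)) :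
    ¬ C'.Bad u := by
  have hmem : C.maxChild (C.maxChild u) ∈ C'.children u :=
    Finset.mem_filter.2 ⟨Finset.mem_univ _, hstep.swap_in u huA huS⟩
  rintro (⟨-, hb⟩ | ⟨hl, -⟩)
  · obtain ⟨v, hv, hvm⟩ := C'.exists_height_eq_maxH ⟨_, hmem⟩
    have := hstep.height_le (hch v hv)
    have := hstep.height_lt_of_mem_children (zero_le_one.trans hα) huS hv
    have := hstep.height_keep u fun h => h.2 huS.1
    omega
  · exact Finset.ne_empty_of_mem hmem hl
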